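/- (Proposition 4.3, Lipschitz part) Let σ_f, σ_l > 0 and let k be the Gaussian kernel on ℝⁿ. Given points x̂₁, …, x̂_N ∈ ℝⁿ and x̂₊₁, …, x̂₊_N ∈ ℝⁿ, λ > 0, let K, K³, W, β, C be as in the context, and fix c ∈ ℝⁿ. Then the function g : ℝⁿ → ℝ defined by g(x) := √((β(x) − β(c))ᵀ K³ (β(x) − β(c))) is Lipschitz continuous with Lipschitz constant C · σ_f / σ_l, i.e., |g(x) − g(x')| ≤ (C σ_f / σ_l) ‖x − x'‖ for all x, x' ∈ ℝⁿ. -/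

import Mathlib

open Matrix
open scoped BigOperators

/-- The Gaussian kernel on `ℝⁿ` with parameters `σf, σl`. -/
noncomputable def gaussianKernel (σf σl : ℝ) {n : ℕ}
    (x y : EuclideanSpace ℝ (Fin n)) : ℝ :=
  σf ^ 2 * Real.exp (-‖x - y‖ ^ 2 / (2 * σl ^ 2))

open MeasureTheory ProbabilityTheory in
theorem exp_neg_norm_sq_eq_integral_cos {n : ℕ} (t : EuclideanSpace ℝ (Fin n)) :
    Real.exp (-‖t‖ ^ 2 / 2) =
      ∫ w, Real.cos (inner ℝ w t) ∂(stdGaussian (EuclideanSpace ℝ (Fin n))) := by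
  have h := charFun_stdGaussian t
  rw [charFun_apply] at h
  have hi : Integrable (fun w : EuclideanSpace ℝ (Fin n) =>
      Complex.exp ((inner ℝ w t : ℝ) * Complex.I)) (stdGaussian _) := by
    refine Integrable.of_bound (by fun_prop) 1 (.of_forall fun w => ?_)
    rw [Complex.norm_exp_ofReal_mul_I]
  have h2 := congrArg Complex.re h
  have h3 := integral_re hi
  simp only [RCLike.re_eq_complex_re, Complex.exp_ofReal_mul_I_re] at h3
  rw [h3, h2, ← Complex.ofReal_pow, ← Complex.ofReal_neg, ← Complex.ofReal_ofNat,
    ← Complex.ofReal_div, Complex.exp_ofReal_re]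

theorem gaussianKernel_eq_mul_exp_norm_sub_sq {n : ℕ} (σf σl : ℝ)
    (x y : EuclideanSpace ℝ (Fin n)) :
    gaussianKernel σf σl x y = σf ^ 2 * Real.exp (-‖σl⁻¹ • x - σl⁻¹ • y‖ ^ 2 / 2) := by
  rw [gaussianKernel, ← smul_sub, norm_smul, mul_pow, Real.norm_eq_abs, sq_abs]
  congr 2
  ring

theorem gaussianKernel_comm {n : ℕ} (σf σl : ℝ) (x y : EuclideanSpace ℝ (Fin n)) :
    gaussianKernel σf σl x y = gaussianKernel σf σl y x := by
  rw [gaussianKernel, gaussianKernel, norm_sub_rev]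

theorem gaussianKernel_self {n : ℕ} (σf σl : ℝ) (x : EuclideanSpace ℝ (Fin n)) :
    gaussianKernel σf σl x x = σf ^ 2 := by
  simp [gaussianKernel]

open MeasureTheory ProbabilityTheory in
theorem gaussianKernel_sum_nonneg {n : ℕ} {ι : Type*} [Fintype ι] (σf σl : ℝ)
    (x : ι → EuclideanSpace ℝ (Fin n)) (a : ι → ℝ) :
    0 ≤ ∑ i, ∑ j, a i * gaussianKernel σf σl (x i) (x j) * a j := by
  have hint (i j : ι) : Integrable (fun w : EuclideanSpace ℝ (Fin n) =>
      a i * Real.cos (inner ℝ w (σl⁻¹ • x i - σl⁻¹ • x j)) * a j) (stdGaussian _) := by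
    refine (Integrable.const_mul ?_ _).mul_const _
    exact Integrable.of_bound (by fun_prop) 1 (.of_forall fun w => Real.abs_cos_le_one _)
  have key : ∑ i, ∑ j, a i * gaussianKernel σf σl (x i) (x j) * a j =
      σf ^ 2 * ∫ w, ∑ i, ∑ j, a i * Real.cos (inner ℝ w (σl⁻¹ • x i - σl⁻¹ • x j)) * a j
        ∂(stdGaussian (EuclideanSpace ℝ (Fin n))) := by
    rw [integral_finsetSum _ fun i _ => integrable_finsetSum _ fun j _ => hint i j,
      Finset.mul_sum]
    refine Finset.sum_congr rfl fun i _ => ?_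
    rw [integral_finsetSum _ fun j _ => hint i j, Finset.mul_sum]
    refine Finset.sum_congr rfl fun j _ => ?_
    rw [integral_mul_const, integral_const_mul, gaussianKernel_eq_mul_exp_norm_sub_sq,
      exp_neg_norm_sq_eq_integral_cos]
    ring
  rw [key]
  refine mul_nonneg (sq_nonneg _) (integral_nonneg fun w => ?_)
  have hsq : ∑ i, ∑ j, a i * Real.cos (inner ℝ w (σl⁻¹ • x i - σl⁻¹ • x j)) * a j =
      (∑ i, a i * Real.cos (inner ℝ w (σl⁻¹ • x i))) ^ 2 +
        (∑ i, a i * Real.sin (inner ℝ w (σl⁻¹ • x i))) ^ 2 := by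
    rw [sq, sq, Finset.sum_mul_sum, Finset.sum_mul_sum, ← Finset.sum_add_distrib]
    refine Finset.sum_congr rfl fun i _ => ?_
    rw [← Finset.sum_add_distrib]
    refine Finset.sum_congr rfl fun j _ => ?_
    rw [inner_sub_right, Real.cos_sub]
    ring
  simp only [Pi.zero_apply]
  rw [hsq]
  positivity

theorem dotProduct_mulVec_eq_sum {ι : Type*} [Fintype ι] (A : Matrix ι ι ℝ) (a : ι → ℝ) :
    a ⬝ᵥ (A *ᵥ a) = ∑ i, ∑ j, a i * A i j * a j := by
  simp only [dotProduct, mulVec, Finset.mul_sum, mul_assoc]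

theorem gaussianKernel_gram_posSemidef {n : ℕ} {ι : Type*} [Fintype ι] (σf σl : ℝ)
    (x : ι → EuclideanSpace ℝ (Fin n)) :
    (Matrix.of fun i j => gaussianKernel σf σl (x i) (x j)).PosSemidef := by
  refine .of_dotProduct_mulVec_nonneg ?_ fun a => ?_
  · ext i j
    simp [gaussianKernel_comm σf σl (x i)]
  · rw [star_trivial, dotProduct_mulVec_eq_sum]
    exact gaussianKernel_sum_nonneg σf σl x a

/-- Cauchy–Schwarz in the reproducing kernel Hilbert space, applied to a difference of two
kernel sections and a linear combination of kernel sections. -/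
theorem gaussianKernel_cauchy_schwarz {n : ℕ} {ι : Type*} [Fintype ι] (σf σl : ℝ)
    (y : ι → EuclideanSpace ℝ (Fin n)) (a : ι → ℝ) (x x' : EuclideanSpace ℝ (Fin n)) :
    (∑ i, a i * (gaussianKernel σf σl x (y i) - gaussianKernel σf σl x' (y i))) ^ 2 ≤
      (2 * (σf ^ 2 - gaussianKernel σf σl x x')) *
        ∑ i, ∑ j, a i * gaussianKernel σf σl (y i) (y j) * a j := by
  have h := discrim_le_zero (a := 2 * (σf ^ 2 - gaussianKernel σf σl x x'))
    (b := 2 * ∑ i, a i * (gaussianKernel σf σl x (y i) - gaussianKernel σf σl x' (y i)))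
    (c := ∑ i, ∑ j, a i * gaussianKernel σf σl (y i) (y j) * a j) fun s => by
      have h := gaussianKernel_sum_nonneg σf σl
        (fun o : Option (Option ι) => o.elim x fun p => p.elim x' y)
        (fun o => o.elim s fun p => p.elim (-s) a)
      simp only [Fintype.sum_option, Option.elim_none, Option.elim_some, gaussianKernel_self,
        Finset.sum_add_distrib, gaussianKernel_comm σf σl x' x,
        gaussianKernel_comm σf σl (y _) x, gaussianKernel_comm σf σl (y _) x'] at h
      have e1 : ∑ i, a i * (gaussianKernel σf σl x (y i) - gaussianKernel σf σl x' (y i)) =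
          ∑ i, a i * gaussianKernel σf σl x (y i) -
            ∑ i, a i * gaussianKernel σf σl x' (y i) := by
        simp only [mul_sub, Finset.sum_sub_distrib]
      have e2 (r : ℝ) (z : EuclideanSpace ℝ (Fin n)) :
          ∑ i, r * gaussianKernel σf σl z (y i) * a i =
            r * ∑ i, a i * gaussianKernel σf σl z (y i) := by
        rw [Finset.mul_sum]
        exact Finset.sum_congr rfl fun i _ => by ring
      have e3 (r : ℝ) (z : EuclideanSpace ℝ (Fin n)) :
          ∑ i, a i * gaussianKernel σf σl z (y i) * r =
            r * ∑ i, a i * gaussianKernel σf σl z (y i) := by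
        rw [Finset.mul_sum]
        exact Finset.sum_congr rfl fun i _ => by ring
      rw [e1]
      rw [e2, e2, e3, e3] at h
      linarith
  rw [discrim] at h
  linarith

theorem two_mul_sub_gaussianKernel_le {n : ℕ} (σf σl : ℝ) (x x' : EuclideanSpace ℝ (Fin n)) :
    2 * (σf ^ 2 - gaussianKernel σf σl x x') ≤ (σf / σl * ‖x - x'‖) ^ 2 := by
  have h := mul_le_mul_of_nonneg_left
    (Real.add_one_le_exp (-‖x - x'‖ ^ 2 / (2 * σl ^ 2))) (sq_nonneg σf)
  have e : (σf / σl * ‖x - x'‖) ^ 2 =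
      -2 * (σf ^ 2 * (-‖x - x'‖ ^ 2 / (2 * σl ^ 2))) := by
    ring
  rw [e, gaussianKernel]
  linarith

theorem Matrix.PosSemidef.abs_sqrt_sub_sqrt_le {ι : Type*} [Fintype ι] {A : Matrix ι ι ℝ}
    (hA : A.PosSemidef) (u v : ι → ℝ) :
    |√(u ⬝ᵥ (A *ᵥ u)) - √(v ⬝ᵥ (A *ᵥ v))| ≤ √((u - v) ⬝ᵥ (A *ᵥ (u - v))) := by
  classical
  obtain ⟨B, rfl⟩ : ∃ B : Matrix ι ι ℝ, A = Bᴴ * B := by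
    open scoped MatrixOrder in
    exact CStarAlgebra.nonneg_iff_eq_star_mul_self.mp hA.nonneg
  have key (w : ι → ℝ) : √(w ⬝ᵥ ((Bᴴ * B) *ᵥ w)) = ‖WithLp.toLp 2 (B *ᵥ w)‖ := by
    rw [EuclideanSpace.norm_eq, ← mulVec_mulVec, dotProduct_mulVec,
      conjTranspose_eq_transpose_of_trivial, vecMul_transpose]
    simp [dotProduct, sq]
  rw [key, key, key, mulVec_sub, WithLp.toLp_sub]
  exact abs_norm_sub_norm_le _ _

theorem Matrix.PosSemidef.sum_mul_nonneg {ι : Type*} [Fintype ι] {A B : Matrix ι ι ℝ}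
    (hA : A.PosSemidef) (hB : B.PosSemidef) : 0 ≤ ∑ i, ∑ j, A i j * B i j := by
  simpa [dotProduct, mulVec] using (hA.hadamard hB).dotProduct_mulVec_nonneg 1

theorem posSemidef_smul_gram_sub_vecMulVec {n : ℕ} {ι : Type*} [Fintype ι] (σf σl : ℝ)
    (y : ι → EuclideanSpace ℝ (Fin n)) (x x' : EuclideanSpace ℝ (Fin n)) :
    ((σf / σl * ‖x - x'‖) ^ 2 • (Matrix.of fun i j => gaussianKernel σf σl (y i) (y j)) -
      vecMulVec (fun i => gaussianKernel σf σl x (y i) - gaussianKernel σf σl x' (y i))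
        (fun i => gaussianKernel σf σl x (y i) - gaussianKernel σf σl x' (y i))).PosSemidef := by
  refine .of_dotProduct_mulVec_nonneg ?_ fun a => ?_
  · ext i j
    simp [gaussianKernel_comm σf σl (y i), vecMulVec_apply, mul_comm]
  · have h1 := gaussianKernel_cauchy_schwarz σf σl y a x x'
    have h2 := mul_le_mul_of_nonneg_right (two_mul_sub_gaussianKernel_le σf σl x x')
      (gaussianKernel_sum_nonneg σf σl y a)
    rw [star_trivial, sub_mulVec, dotProduct_sub, smul_mulVec, dotProduct_smul,
      dotProduct_mulVec_eq_sum, vecMulVec_mulVec, sub_nonneg]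
    refine le_trans (le_of_eq ?_) (h1.trans h2)
    rw [dotProduct_smul, op_smul_eq_smul, smul_eq_mul, dotProduct_comm _ a, ← sq]
    rfl

theorem cme_discretization_fn_lipschitz {n N : ℕ} (σf σl : ℝ)
    (hσf : 0 < σf) (hσl : 0 < σl)
    (k : EuclideanSpace ℝ (Fin n) → EuclideanSpace ℝ (Fin n) → ℝ)
    (hk : k = gaussianKernel σf σl)
    (xh xp : Fin N → EuclideanSpace ℝ (Fin n))
    (lam : ℝ) (hlam : 0 < lam)
    (K : Matrix (Fin N) (Fin N) ℝ) (hKdef : ∀ i j, K i j = k (xh i) (xh j))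
    (K3 : Matrix (Fin N) (Fin N) ℝ) (hK3def : ∀ i j, K3 i j = k (xp i) (xp j))
    (W : Matrix (Fin N) (Fin N) ℝ)
    (hW : W = (K + ((N : ℝ) * lam) • (1 : Matrix (Fin N) (Fin N) ℝ))⁻¹)
    (β : EuclideanSpace ℝ (Fin n) → (Fin N → ℝ))
    (hβ : ∀ x, β x = W *ᵥ (fun i => k x (xh i)))
    (C : ℝ) (hC : C = Real.sqrt (∑ i, ∑ j, (W * K * Wᵀ) i j * K3 i j))
    (c : EuclideanSpace ℝ (Fin n))
    (g : EuclideanSpace ℝ (Fin n) → ℝ)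
    (hg : ∀ x, g x = Real.sqrt ((β x - β c) ⬝ᵥ (K3 *ᵥ (β x - β c)))) :
    ∀ x x' : EuclideanSpace ℝ (Fin n),
      |g x - g x'| ≤ (C * σf / σl) * ‖x - x'‖ := by
  subst hk
  obtain rfl : K = Matrix.of fun i j => gaussianKernel σf σl (xh i) (xh j) := by
    ext i j
    exact hKdef i j
  obtain rfl : K3 = Matrix.of fun i j => gaussianKernel σf σl (xp i) (xp j) := by
    ext i j
    exact hK3def i j
  intro x x'
  have hK3 := gaussianKernel_gram_posSemidef σf σl xp
  set K := Matrix.of fun i j => gaussianKernel σf σl (xh i) (xh j)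
  set K3 := Matrix.of fun i j => gaussianKernel σf σl (xp i) (xp j)
  set v : Fin N → ℝ := fun i => gaussianKernel σf σl x (xh i) - gaussianKernel σf σl x' (xh i)
  set r := σf / σl * ‖x - x'‖
  have hβv : β x - β c - (β x' - β c) = W *ᵥ v := by
    rw [sub_sub_sub_cancel_right, hβ, hβ, ← mulVec_sub]
    rfl
  rw [hg, hg]
  refine (hK3.abs_sqrt_sub_sqrt_le _ _).trans ?_
  have hM := (posSemidef_smul_gram_sub_vecMulVec σf σl xh x x').mul_mul_conjTranspose_same W
  have hsum := hM.sum_mul_nonneg hK3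
  have hr : 0 ≤ r := by positivity
  rw [hβv, hC, show √(∑ i, ∑ j, (W * K * Wᵀ) i j * K3 i j) * σf / σl * ‖x - x'‖ =
    r * √(∑ i, ∑ j, (W * K * Wᵀ) i j * K3 i j) by ring, ← Real.sqrt_sq hr,
    ← Real.sqrt_mul (sq_nonneg r)]
  refine Real.sqrt_le_sqrt ?_
  rw [conjTranspose_eq_transpose_of_trivial, Matrix.mul_sub, Matrix.sub_mul, Matrix.mul_smul,
    Matrix.smul_mul, mul_vecMulVec, vecMulVec_mul, vecMul_transpose] at hsum
  simp only [Matrix.sub_apply, Matrix.smul_apply, vecMulVec_apply, sub_mul,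
    Finset.sum_sub_distrib, smul_eq_mul, mul_assoc, ← Finset.mul_sum] at hsum
  rw [dotProduct_mulVec_eq_sum]
  simp only [mul_assoc, Finset.mul_sum] at hsum ⊢
  refine le_trans (le_of_eq ?_) (sub_nonneg.mp hsum)
  refine Finset.sum_congr rfl fun i _ => Finset.sum_congr rfl fun j _ => ?_
  ring
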